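/- For every set of axioms Ax ⊆ L⇛ and every consecution Γ ⇒ φ: Γ ⊢_Ax φ if and only if L-HAE(Ax) ⊨ Γ ⇒ φ, i.e. if and only if there exists a finite Γ' ⊆ Γ such that every L-HAE validating all formulas of Ax validates (⋀Γ')→φ. -/

import Mathlib

/-- Formulas of the language `L⇛`. -/
inductive Fml : Type where
  | var : Nat → Fml
  | top : Fml
  | bot : Fml
  | and : Fml → Fml → Fml
  | or  : Fml → Fml → Fml
  | imp : Fml → Fml → Fml
  | sto : Fml → Fml → Fml
deriving DecidableEq

/-- Uniform substitution. -/
def Fml.subst (σ : Nat → Fml) : Fml → Fml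
  | .var p => σ p
  | .top => .top
  | .bot => .bot
  | .and φ ψ => .and (φ.subst σ) (ψ.subst σ)
  | .or φ ψ => .or (φ.subst σ) (ψ.subst σ)
  | .imp φ ψ => .imp (φ.subst σ) (ψ.subst σ)
  | .sto φ ψ => .sto (φ.subst σ) (ψ.subst σ)

/-- Conjunction `φ₁ ∧ ⋯ ∧ φₙ` of a list of formulas (`⊤` for the empty list). -/
def Fml.conj : List Fml → Fml
  | [] => .top
  | [φ] => φ
  | φ :: ψ :: rest => .and φ (Fml.conj (ψ :: rest))

/-- Disjunction `φ₁ ∨ ⋯ ∨ φₙ` of a list of formulas (`⊥` for the empty list). -/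
def Fml.disj : List Fml → Fml
  | [] => .bot
  | [φ] => φ
  | φ :: ψ :: rest => .or φ (Fml.disj (ψ :: rest))

/-- Axiom schemes of intuitionistic propositional logic (a standard Hilbert-style
axiomatisation); as schemes, they comprise all substitution instances. -/
inductive IpcAx : Fml → Prop where
  | k (φ ψ : Fml) : IpcAx (.imp φ (.imp ψ φ))
  | s (φ ψ χ : Fml) : IpcAx (.imp (.imp φ (.imp ψ χ)) (.imp (.imp φ ψ) (.imp φ χ)))
  | andE1 (φ ψ : Fml) : IpcAx (.imp (.and φ ψ) φ)
  | andE2 (φ ψ : Fml) : IpcAx (.imp (.and φ ψ) ψ)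
  | andI (φ ψ : Fml) : IpcAx (.imp φ (.imp ψ (.and φ ψ)))
  | orI1 (φ ψ : Fml) : IpcAx (.imp φ (.or φ ψ))
  | orI2 (φ ψ : Fml) : IpcAx (.imp ψ (.or φ ψ))
  | orE (φ ψ χ : Fml) : IpcAx (.imp (.imp φ χ) (.imp (.imp ψ χ) (.imp (.or φ ψ) χ)))
  | botE (φ : Fml) : IpcAx (.imp .bot φ)
  | top : IpcAx .top

/-- Substitution instances of the axioms of intuitionistic logic together with
`k_a : ((p⇛q)∧(p⇛r))→(p⇛(q∧r))` and `tr : ((p⇛q)∧(q⇛r))→(p⇛r)`. -/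
inductive BaseAx : Fml → Prop where
  | ipc {φ : Fml} : IpcAx φ → BaseAx φ
  | ka (φ ψ χ : Fml) : BaseAx (.imp (.and (.sto φ ψ) (.sto φ χ)) (.sto φ (.and ψ χ)))
  | tr (φ ψ χ : Fml) : BaseAx (.imp (.and (.sto φ ψ) (.sto ψ χ)) (.sto φ χ))

/-- Derivability of the consecution `Γ ⇒ φ` in `HLC♭ ⊕ Ax`, i.e. `Γ ⊢_Ax φ`. -/
inductive Deriv (Ax : Set Fml) : Set Fml → Fml → Prop where
  | base {Γ : Set Fml} {φ : Fml} : BaseAx φ → Deriv Ax Γ φ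
  | axm {Γ : Set Fml} {ψ : Fml} (σ : Nat → Fml) : ψ ∈ Ax → Deriv Ax Γ (ψ.subst σ)
  | el {Γ : Set Fml} {φ : Fml} : φ ∈ Γ → Deriv Ax Γ φ
  | mp {Γ : Set Fml} {φ ψ : Fml} : Deriv Ax Γ φ → Deriv Ax Γ (.imp φ ψ) → Deriv Ax Γ ψ
  | na {Γ : Set Fml} {φ ψ : Fml} : Deriv Ax (∅ : Set Fml) (.imp φ ψ) → Deriv Ax Γ (.sto φ ψ)

/-- Evaluation of a formula in a Heyting algebra equipped with a binary
operation `⇛`, extending a valuation of the proposition letters. -/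
def algEval {A : Type} [HeytingAlgebra A] (sto : A → A → A) (v : Nat → A) : Fml → A
  | .var p => v p
  | .top => ⊤
  | .bot => ⊥
  | .and φ ψ => algEval sto v φ ⊓ algEval sto v ψ
  | .or φ ψ => algEval sto v φ ⊔ algEval sto v ψ
  | .imp φ ψ => algEval sto v φ ⇨ algEval sto v ψ
  | .sto φ ψ => sto (algEval sto v φ) (algEval sto v ψ)

/-- A binary operation `⇛` on a Heyting algebra makes it a flat Lewisian Heyting
algebra expansion (L-HAE) if it satisfies `(a⇛b)⊓(a⇛c) = a⇛(b⊓c)`,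
`(a⇛b)⊓(b⇛c) ≤ a⇛c` and `a⇛a = ⊤`. -/
def IsLHAE {A : Type} [HeytingAlgebra A] (sto : A → A → A) : Prop :=
  (∀ a b c : A, sto a b ⊓ sto a c = sto a (b ⊓ c)) ∧
  (∀ a b c : A, sto a b ⊓ sto b c ≤ sto a c) ∧
  (∀ a : A, sto a a = ⊤)

namespace Fml

/-- The value of a conjunction is the greatest lower bound of the values of the conjuncts. -/
theorem le_algEval_conj_iff {A : Type} [HeytingAlgebra A] (sto : A → A → A) (v : Nat → A) (a : A) :
    ∀ L : List Fml, a ≤ algEval sto v (conj L) ↔ ∀ ψ ∈ L, a ≤ algEval sto v ψ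
  | [] => by simp [conj, algEval]
  | [ψ] => by simp [conj]
  | ψ :: χ :: L => by
      simp [conj, algEval, le_algEval_conj_iff sto v a (χ :: L)]

theorem algEval_conj_anti {A : Type} [HeytingAlgebra A] (sto : A → A → A) (v : Nat → A)
    {L M : List Fml} (h : L ⊆ M) : algEval sto v (conj M) ≤ algEval sto v (conj L) :=
  (le_algEval_conj_iff sto v _ L).2 fun ψ hψ =>
    (le_algEval_conj_iff sto v _ M).1 le_rfl ψ (h hψ)

theorem algEval_subst {A : Type} [HeytingAlgebra A] (sto : A → A → A) (v : Nat → A)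
    (σ : Nat → Fml) (ψ : Fml) :
    algEval sto v (ψ.subst σ) = algEval sto (fun n => algEval sto v (σ n)) ψ := by
  induction ψ <;> simp_all [subst, algEval]

end Fml

theorem IsLHAE.sto_eq_top {A : Type} [HeytingAlgebra A] {sto : A → A → A} (h : IsLHAE sto)
    {a b : A} (hab : a ≤ b) : sto a b = ⊤ := by
  have := h.1 a a b
  rwa [inf_eq_left.2 hab, h.2.2, top_inf_eq] at this

theorem IpcAx.algEval_eq_top {A : Type} [HeytingAlgebra A] (sto : A → A → A) (v : Nat → A)
    {φ : Fml} (h : IpcAx φ) : algEval sto v φ = ⊤ := by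
  cases h with
  | s φ ψ χ =>
    simp only [algEval, himp_eq_top_iff, le_himp_iff]
    generalize algEval sto v φ = a
    generalize algEval sto v ψ = b
    generalize algEval sto v χ = c
    have h₁ : (a ⇨ b ⇨ c) ⊓ (a ⇨ b) ⊓ a ≤ b :=
      (inf_le_inf_right _ inf_le_right).trans himp_inf_le
    have h₂ : (a ⇨ b ⇨ c) ⊓ (a ⇨ b) ⊓ a ≤ b ⇨ c :=
      (inf_le_inf_right _ inf_le_left).trans himp_inf_le
    exact (le_inf h₂ h₁).trans himp_inf_le
  | orE φ ψ χ =>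
    simp only [algEval, himp_eq_top_iff, le_himp_iff, inf_sup_left, sup_le_iff]
    exact ⟨(inf_le_inf_right _ inf_le_left).trans himp_inf_le,
      (inf_le_inf_right _ inf_le_right).trans himp_inf_le⟩
  | _ => simp [algEval]

theorem BaseAx.algEval_eq_top {A : Type} [HeytingAlgebra A] {sto : A → A → A} (hs : IsLHAE sto)
    (v : Nat → A) {φ : Fml} (h : BaseAx φ) : algEval sto v φ = ⊤ := by
  cases h with
  | ipc h => exact h.algEval_eq_top sto v
  | ka φ ψ χ => exact himp_eq_top_iff.2 (hs.1 _ _ _).le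
  | tr φ ψ χ => exact himp_eq_top_iff.2 (hs.2.1 _ _ _)

namespace Deriv

variable {Ax Γ : Set Fml} {φ ψ χ θ : Fml}

theorem sound (h : Deriv Ax Γ φ) :
    ∃ L : List Fml, (∀ ψ ∈ L, ψ ∈ Γ) ∧
      ∀ (A : Type) [HeytingAlgebra A] (sto : A → A → A), IsLHAE sto →
        (∀ ψ ∈ Ax, ∀ v : Nat → A, algEval sto v ψ = ⊤) →
        ∀ v : Nat → A, algEval sto v (Fml.conj L) ≤ algEval sto v φ := by
  induction h with
  | base h =>
    exact ⟨[], by simp, fun A _ sto hs _ v => by rw [h.algEval_eq_top hs v]; exact le_top⟩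
  | axm σ h =>
    refine ⟨[], by simp, fun A _ sto hs hAx v => ?_⟩
    rw [Fml.algEval_subst, hAx _ h]
    exact le_top
  | @el Γ φ h => exact ⟨[φ], by simpa using h, fun A _ sto _ _ v => le_rfl⟩
  | mp _ _ ih₁ ih₂ =>
    obtain ⟨L, hL, h₁⟩ := ih₁
    obtain ⟨M, hM, h₂⟩ := ih₂
    refine ⟨L ++ M, fun ψ hψ => (List.mem_append.1 hψ).elim (hL ψ) (hM ψ),
      fun A _ sto hs hAx v => ?_⟩
    have h₁ := (Fml.algEval_conj_anti sto v (List.subset_append_left L M)).trans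
      (h₁ A sto hs hAx v)
    have h₂ := (Fml.algEval_conj_anti sto v (List.subset_append_right L M)).trans
      (h₂ A sto hs hAx v)
    exact (le_inf h₂ h₁).trans himp_inf_le
  | na _ ih =>
    obtain ⟨L, hL, h⟩ := ih
    obtain rfl : L = [] := List.eq_nil_iff_forall_not_mem.2 hL
    refine ⟨[], by simp, fun A _ sto hs hAx v => ?_⟩
    have h := top_le_iff.1 (h A sto hs hAx v)
    exact le_top.trans (hs.sto_eq_top (himp_eq_top_iff.1 h)).ge

theorem of_empty (h : Deriv Ax ∅ φ) : Deriv Ax Γ φ := by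
  generalize hΔ : (∅ : Set Fml) = Δ at h
  induction h with
  | base h => exact .base h
  | axm σ h => exact .axm σ h
  | el h => simp [← hΔ] at h
  | mp _ _ ih₁ ih₂ => exact .mp (ih₁ hΔ) (ih₂ hΔ)
  | na h _ => exact .na h

theorem ipc (h : IpcAx φ) : Deriv Ax Γ φ := .base (.ipc h)

theorem imp_const (h : Deriv Ax Γ φ) : Deriv Ax Γ (.imp ψ φ) := h.mp (ipc (.k _ _))

theorem imp_mp (h₁ : Deriv Ax Γ (.imp φ ψ)) (h₂ : Deriv Ax Γ (.imp φ (.imp ψ χ))) :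
    Deriv Ax Γ (.imp φ χ) :=
  h₁.mp (h₂.mp (ipc (.s _ _ _)))

theorem imp_trans (h₁ : Deriv Ax Γ (.imp φ ψ)) (h₂ : Deriv Ax Γ (.imp ψ χ)) :
    Deriv Ax Γ (.imp φ χ) :=
  h₁.imp_mp h₂.imp_const

theorem imp_refl : Deriv Ax Γ (.imp φ φ) :=
  imp_mp (ψ := .imp φ φ) (ipc (.k _ _)) (ipc (.k _ _))

theorem imp_and (h₁ : Deriv Ax Γ (.imp φ ψ)) (h₂ : Deriv Ax Γ (.imp φ χ)) :
    Deriv Ax Γ (.imp φ (.and ψ χ)) :=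
  h₂.imp_mp (h₁.imp_trans (ipc (.andI _ _)))

theorem or_imp (h₁ : Deriv Ax Γ (.imp φ χ)) (h₂ : Deriv Ax Γ (.imp ψ χ)) :
    Deriv Ax Γ (.imp (.or φ ψ) χ) :=
  h₂.mp (h₁.mp (ipc (.orE _ _ _)))

theorem imp_imp_iff :
    Deriv Ax Γ (.imp φ (.imp ψ χ)) ↔ Deriv Ax Γ (.imp (.and φ ψ) χ) :=
  ⟨fun h => imp_mp (ipc (.andE2 _ _)) ((ipc (.andE1 _ _)).imp_trans h),
    fun h => (ipc (.andI _ _)).imp_trans (h.imp_const.mp (ipc (.s _ _ _)))⟩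

theorem sto_mono (h₁ : Deriv Ax ∅ (.imp ψ φ)) (h₂ : Deriv Ax ∅ (.imp χ θ)) :
    Deriv Ax Γ (.imp (.sto φ χ) (.sto ψ θ)) :=
  imp_trans (imp_and (imp_trans (imp_and (na h₁).imp_const imp_refl) (.base (.tr _ _ _)))
    (na h₂).imp_const) (.base (.tr _ _ _))

theorem conj : ∀ {L : List Fml}, (∀ ψ ∈ L, Deriv Ax Γ ψ) → Deriv Ax Γ (Fml.conj L)
  | [], _ => ipc .top
  | [ψ], h => h ψ (by simp)
  | ψ :: χ :: L, h =>
    (conj (L := χ :: L) fun θ hθ => h θ (List.mem_cons_of_mem _ hθ)).mp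
      ((h ψ (by simp)).mp (ipc (.andI _ _)))

end Deriv

/-- Provable equivalence of formulas in `HLC♭ ⊕ Ax`. -/
def provableSetoid (Ax : Set Fml) : Setoid Fml where
  r φ ψ := Deriv Ax ∅ (.imp φ ψ) ∧ Deriv Ax ∅ (.imp ψ φ)
  iseqv := ⟨fun _ => ⟨.imp_refl, .imp_refl⟩, fun h => ⟨h.2, h.1⟩,
    fun h₁ h₂ => ⟨h₁.1.imp_trans h₂.1, h₂.2.imp_trans h₁.2⟩⟩

/-- The Lindenbaum–Tarski algebra of `HLC♭ ⊕ Ax`. -/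
def Lindenbaum (Ax : Set Fml) : Type := Quotient (provableSetoid Ax)

namespace Lindenbaum

variable {Ax : Set Fml}

/-- The class of a formula in the Lindenbaum–Tarski algebra. -/
def mk (Ax : Set Fml) (φ : Fml) : Lindenbaum Ax := Quotient.mk (provableSetoid Ax) φ

theorem ind {p : Lindenbaum Ax → Prop} (h : ∀ φ, p (mk Ax φ)) (a : Lindenbaum Ax) : p a :=
  Quotient.ind h a

/-- A binary connective respecting provable equivalence acts on the Lindenbaum–Tarski algebra. -/
def lift₂ (f : Fml → Fml → Fml)
    (hf : ∀ {φ φ' ψ ψ'}, Deriv Ax ∅ (.imp φ φ') → Deriv Ax ∅ (.imp φ' φ) →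
      Deriv Ax ∅ (.imp ψ ψ') → Deriv Ax ∅ (.imp ψ' ψ) → Deriv Ax ∅ (.imp (f φ ψ) (f φ' ψ'))) :
    Lindenbaum Ax → Lindenbaum Ax → Lindenbaum Ax :=
  Quotient.map₂ f fun _ _ h₁ _ _ h₂ => ⟨hf h₁.1 h₁.2 h₂.1 h₂.2, hf h₁.2 h₁.1 h₂.2 h₂.1⟩

instance : PartialOrder (Lindenbaum Ax) where
  le := Quotient.lift₂ (fun φ ψ => Deriv Ax ∅ (.imp φ ψ)) fun _ _ _ _ h₁ h₂ =>
    propext ⟨fun h => h₁.2.imp_trans (h.imp_trans h₂.1), fun h => h₁.1.imp_trans (h.imp_trans h₂.2)⟩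
  le_refl := ind fun _ => Deriv.imp_refl
  le_trans := ind fun _ => ind fun _ => ind fun _ => Deriv.imp_trans
  le_antisymm := ind fun _ => ind fun _ h₁ h₂ => Quotient.sound ⟨h₁, h₂⟩

instance : HeytingAlgebra (Lindenbaum Ax) where
  inf := lift₂ .and fun h₁ _ h₂ _ =>
    ((Deriv.ipc (.andE1 _ _)).imp_trans h₁).imp_and ((Deriv.ipc (.andE2 _ _)).imp_trans h₂)
  sup := lift₂ .or fun h₁ _ h₂ _ =>
    (h₁.imp_trans (.ipc (.orI1 _ _))).or_imp (h₂.imp_trans (.ipc (.orI2 _ _)))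
  himp := lift₂ .imp fun _ h₁ h₂ _ => Deriv.imp_imp_iff.2 <|
    (((Deriv.ipc (.andE2 _ _)).imp_trans h₁).imp_mp (.ipc (.andE1 _ _))).imp_trans h₂
  top := mk Ax .top
  bot := mk Ax .bot
  compl a := lift₂ .imp (fun _ h₁ h₂ _ => Deriv.imp_imp_iff.2 <|
    (((Deriv.ipc (.andE2 _ _)).imp_trans h₁).imp_mp (.ipc (.andE1 _ _))).imp_trans h₂) a (mk Ax .bot)
  inf_le_left := ind fun _ => ind fun _ => Deriv.ipc (.andE1 _ _)
  inf_le_right := ind fun _ => ind fun _ => Deriv.ipc (.andE2 _ _)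
  le_inf := ind fun _ => ind fun _ => ind fun _ => Deriv.imp_and
  le_sup_left := ind fun _ => ind fun _ => Deriv.ipc (.orI1 _ _)
  le_sup_right := ind fun _ => ind fun _ => Deriv.ipc (.orI2 _ _)
  sup_le := ind fun _ => ind fun _ => ind fun _ => Deriv.or_imp
  le_top := ind fun _ => (Deriv.ipc .top).imp_const
  bot_le := ind fun _ => Deriv.ipc (.botE _)
  le_himp_iff := ind fun _ => ind fun _ => ind fun _ => Deriv.imp_imp_iff
  himp_bot _ := rfl

/-- The operation `⇛` on the Lindenbaum–Tarski algebra. -/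
def sto : Lindenbaum Ax → Lindenbaum Ax → Lindenbaum Ax :=
  lift₂ .sto fun _ h₁ h₂ _ => Deriv.sto_mono h₁ h₂

theorem mk_le_mk {φ ψ : Fml} : mk Ax φ ≤ mk Ax ψ ↔ Deriv Ax ∅ (.imp φ ψ) := Iff.rfl

theorem mk_eq_top {φ : Fml} (h : Deriv Ax ∅ φ) : mk Ax φ = ⊤ :=
  top_le_iff.1 (mk_le_mk.2 h.imp_const)

theorem isLHAE_sto : IsLHAE (sto (Ax := Ax)) := by
  refine ⟨ind fun φ => ind fun ψ => ind fun χ => le_antisymm ?_ (le_inf ?_ ?_),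
    ind fun φ => ind fun ψ => ind fun χ => ?_, ind fun φ => ?_⟩
  · exact mk_le_mk.2 (.base (.ka φ ψ χ))
  · exact mk_le_mk.2 (.sto_mono .imp_refl (.ipc (.andE1 ψ χ)))
  · exact mk_le_mk.2 (.sto_mono .imp_refl (.ipc (.andE2 ψ χ)))
  · exact mk_le_mk.2 (.base (.tr φ ψ χ))
  · exact mk_eq_top (.na .imp_refl)

theorem algEval_mk (σ : Nat → Fml) (ψ : Fml) :
    algEval sto (fun n => mk Ax (σ n)) ψ = mk Ax (ψ.subst σ) := by
  induction ψ with
  | var _ | top | bot => rfl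
  | and _ _ h₁ h₂ | or _ _ h₁ h₂ | imp _ _ h₁ h₂ | sto _ _ h₁ h₂ =>
    rw [algEval, h₁, h₂]; rfl

theorem algEval_eq_top {ψ : Fml} (h : ψ ∈ Ax) (v : Nat → Lindenbaum Ax) :
    algEval sto v ψ = ⊤ := by
  choose σ hσ using fun n => Quotient.exists_rep (v n)
  obtain rfl : (fun n => mk Ax (σ n)) = v := funext hσ
  rw [algEval_mk]
  exact mk_eq_top (.axm σ h)

end Lindenbaum

theorem Fml.subst_var (ψ : Fml) : ψ.subst .var = ψ := by
  induction ψ <;> simp_all [subst]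

/-- algebraic soundness and completeness of `HLC♭ ⊕ Ax` with respect
to L-HAEs validating `Ax`: `Γ ⊢_Ax φ` iff there is a finite `Γ' ⊆ Γ` such that
every L-HAE validating all formulas of `Ax` validates `(⋀Γ') → φ`. -/
theorem algebraic_soundness_completeness (Ax Γ : Set Fml) (φ : Fml) :
    Deriv Ax Γ φ ↔
    ∃ L : List Fml, (∀ ψ ∈ L, ψ ∈ Γ) ∧
      ∀ (A : Type) [HeytingAlgebra A] (sto : A → A → A), IsLHAE sto →
        (∀ ψ ∈ Ax, ∀ v : Nat → A, algEval sto v ψ = ⊤) →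
        ∀ v : Nat → A, algEval sto v (.imp (Fml.conj L) φ) = ⊤ := by
  constructor
  · intro h
    obtain ⟨L, hL, hv⟩ := h.sound
    exact ⟨L, hL, fun A _ sto hs hAx v => himp_eq_top_iff.2 (hv A sto hs hAx v)⟩
  · rintro ⟨L, hL, h⟩
    have h := h (Lindenbaum Ax) Lindenbaum.sto Lindenbaum.isLHAE_sto
      (fun _ hψ => Lindenbaum.algEval_eq_top hψ) fun n => Lindenbaum.mk Ax (.var n)
    rw [algEval, himp_eq_top_iff, Lindenbaum.algEval_mk, Lindenbaum.algEval_mk,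
      Lindenbaum.mk_le_mk, Fml.subst_var, Fml.subst_var] at h
    exact (Deriv.conj fun ψ hψ => .el (hL ψ hψ)).mp h.of_empty
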